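/- arXiv:1905.09254 — 5 statements merged into one kernel-verified Lean document; each statement's English description precedes it below -/
import Mathlib

section
/- Let E ∈ Gr′ᵏ. Then for every i with 1 ≤ i ≤ k, the subspace E ∩ V_{[1,N−k+i]} has dimension i; and for every i with k+1 ≤ i ≤ N−1, one has E ∩ V_{[1,i−k]} = 0, so that the subspace E + V_{[1,i−k]} has dimension i. (In particular the subspaces E_1 ⊆ E_2 ⊆ … ⊆ E_{N−1} defined by E_i = E ∩ V_{[1,N−k+i]} for i ∈ [1,k−1], E_k = E, E_i = E ⊕ V_{[1,i−k]} for i ∈ [k+1,N−1] form a complete flag with dim E_i = i.) -/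
/-- `V_I`: the span of the standard basis vectors `e_i` for `i ∈ S`. -/
noncomputable def coordSubspace (N : ℕ) (S : Set (Fin N)) : Submodule ℝ (Fin N → ℝ) :=
  Submodule.span ℝ ((fun i => (Pi.single i 1 : Fin N → ℝ)) '' S)

/-- The span of the first `m` standard basis vectors has dimension `m`. -/
lemma finrank_coordSubspace_lt {N m : ℕ} (hm : m ≤ N) :
    Module.finrank ℝ (coordSubspace N {j : Fin N | (j : ℕ) < m}) = m := by
  have hli : LinearIndependent ℝ (fun i : Fin m => (Pi.single (Fin.castLE hm i) 1 : Fin N → ℝ)) := by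
    simpa [Function.comp_def] using
      (Pi.basisFun ℝ (Fin N)).linearIndependent.comp _ (Fin.castLE_injective hm)
  have hrange : (fun i : Fin N => (Pi.single i 1 : Fin N → ℝ)) '' {j : Fin N | (j : ℕ) < m} =
      Set.range (fun i : Fin m => (Pi.single (Fin.castLE hm i) 1 : Fin N → ℝ)) := by
    ext v
    constructor
    · rintro ⟨j, hj, rfl⟩
      exact ⟨⟨j, hj⟩, rfl⟩
    · rintro ⟨i, rfl⟩
      exact ⟨Fin.castLE hm i, i.isLt, rfl⟩
  rw [coordSubspace, hrange, finrank_span_eq_card hli, Fintype.card_fin]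

lemma coordSubspace_mono {N : ℕ} {S T : Set (Fin N)} (h : S ⊆ T) :
    coordSubspace N S ≤ coordSubspace N T :=
  Submodule.span_mono (Set.image_mono h)

/-- If `E ∈ Gr′ᵏ` (i.e. `E` is `k`-dimensional and `E ∩ V_I = 0` whenever `|I| = N - k`), then
`dim (E ∩ V_{[1,N-k+i]}) = i` for `1 ≤ i ≤ k`, and for `k+1 ≤ i ≤ N-1` one has
`E ∩ V_{[1,i-k]} = 0` and `dim (E + V_{[1,i-k]}) = i`.
Here the 1-indexed interval `[1,m]` corresponds to `{j : Fin N | (j : ℕ) < m}`. -/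
theorem stmt2 (N k : ℕ) (hN : 2 ≤ N) (hk1 : 1 ≤ k) (hk2 : k ≤ N - 1)
    (E : Submodule ℝ (Fin N → ℝ)) (hE : Module.finrank ℝ E = k)
    (hgen : ∀ I : Finset (Fin N), I.card = N - k → E ⊓ coordSubspace N ↑I = ⊥) :
    (∀ i : ℕ, 1 ≤ i → i ≤ k →
      Module.finrank ℝ ↥(E ⊓ coordSubspace N {j : Fin N | (j : ℕ) < N - k + i}) = i) ∧
    (∀ i : ℕ, k + 1 ≤ i → i ≤ N - 1 →
      E ⊓ coordSubspace N {j : Fin N | (j : ℕ) < i - k} = ⊥ ∧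
      Module.finrank ℝ ↥(E ⊔ coordSubspace N {j : Fin N | (j : ℕ) < i - k}) = i) := by
  have hbot : E ⊓ coordSubspace N {j : Fin N | (j : ℕ) < N - k} = ⊥ := by
    have hcard : (Finset.univ.filter fun j : Fin N => (j : ℕ) < N - k).card = N - k := by
      rw [Fin.card_filter_val_lt]
      omega
    simpa using hgen _ hcard
  have htop : E ⊔ coordSubspace N {j : Fin N | (j : ℕ) < N - k} = ⊤ := by
    apply Submodule.eq_top_of_finrank_eq
    have h := Submodule.finrank_sup_add_finrank_inf_eq E
      (coordSubspace N {j : Fin N | (j : ℕ) < N - k})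
    rw [hbot, finrank_bot, hE, finrank_coordSubspace_lt (by omega)] at h
    rw [Module.finrank_fin_fun]
    omega
  refine ⟨fun i _ hik => ?_, fun i hki hiN => ?_⟩
  · have hsup : E ⊔ coordSubspace N {j : Fin N | (j : ℕ) < N - k + i} = ⊤ :=
      top_unique (htop ▸ sup_le_sup_left (coordSubspace_mono fun j (hj : (j : ℕ) < N - k) =>
        show (j : ℕ) < N - k + i by omega) E)
    have h := Submodule.finrank_sup_add_finrank_inf_eq E
      (coordSubspace N {j : Fin N | (j : ℕ) < N - k + i})
    rw [hsup, finrank_top, Module.finrank_fin_fun, hE, finrank_coordSubspace_lt (by omega)] at h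
    omega
  · have hinf : E ⊓ coordSubspace N {j : Fin N | (j : ℕ) < i - k} = ⊥ :=
      bot_unique (hbot ▸ inf_le_inf_left E (coordSubspace_mono fun j (hj : (j : ℕ) < i - k) =>
        show (j : ℕ) < N - k by omega))
    refine ⟨hinf, ?_⟩
    have h := Submodule.finrank_sup_add_finrank_inf_eq E
      (coordSubspace N {j : Fin N | (j : ℕ) < i - k})
    rw [hinf, finrank_bot, hE, finrank_coordSubspace_lt (by omega)] at h
    omega
end

section
/- Let E ∈ Gr′ᵏ. Then for every i with 1 ≤ i ≤ N−k−1 one has (E + V_{[N−i+1,N]}) ∩ (E + V_{[1,N−k−i]}) = E. (This is condition (iv) in the definition of genericity, verified for elements of Gr′ᵏ in 0.4(b): E′_{k+i} ∩ E_{N−i} = E for i ∈ [1,N−k−1].) -/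
theorem Submodule.sup_inf_sup_eq_left_of_disjoint {R M : Type*} [Ring R] [AddCommGroup M]
    [Module R M] {E A B : Submodule R M} (hE : E ⊓ (A ⊔ B) = ⊥) (hAB : Disjoint A B) :
    (E ⊔ A) ⊓ (E ⊔ B) = E := by
  refine le_antisymm ?_ (le_inf le_sup_left le_sup_left)
  rintro x ⟨hxA, hxB⟩
  obtain ⟨e, he, a, ha, rfl⟩ := Submodule.mem_sup.1 hxA
  obtain ⟨e', he', b, hb, h⟩ := Submodule.mem_sup.1 hxB
  have hdiff : e' - e = a - b := by
    rw [sub_eq_sub_iff_add_eq_add, h, add_comm]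
  have hzero : a - b ∈ E ⊓ (A ⊔ B) :=
    ⟨hdiff ▸ E.sub_mem he' he,
      Submodule.sub_mem _ (Submodule.mem_sup_left ha) (Submodule.mem_sup_right hb)⟩
  rw [hE, Submodule.mem_bot, sub_eq_zero] at hzero
  have ha0 : a = 0 := Submodule.disjoint_def.1 hAB a ha (hzero ▸ hb)
  simpa [ha0] using he

theorem disjoint_coordSubspace {N : ℕ} {S T : Set (Fin N)} (h : Disjoint S T) :
    Disjoint (coordSubspace N S) (coordSubspace N T) := by
  have hli := (Pi.basisFun ℝ (Fin N)).linearIndependent.disjoint_span_image h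
  simpa only [coordSubspace, Pi.basisFun_apply] using hli

theorem coordSubspace_union (N : ℕ) (S T : Set (Fin N)) :
    coordSubspace N (S ∪ T) = coordSubspace N S ⊔ coordSubspace N T := by
  simp only [coordSubspace, Set.image_union, Submodule.span_union]

theorem Fin.card_filter_le_or_lt {N a b : ℕ} (hab : a ≤ b) (hb : b ≤ N) :
    (Finset.univ.filter fun j : Fin N => b ≤ (j : ℕ) ∨ (j : ℕ) < a).card = N - b + a := by
  have hmap : (Finset.univ.filter fun j : Fin N => b ≤ (j : ℕ) ∨ (j : ℕ) < a).map
      Fin.valEmbedding = Finset.Ico b N ∪ Finset.range a := by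
    ext m
    simp only [Finset.mem_map, Finset.mem_filter, Finset.mem_univ, true_and,
      Fin.valEmbedding_apply, Finset.mem_union, Finset.mem_Ico, Finset.mem_range]
    constructor
    · rintro ⟨j, hj, rfl⟩
      have := j.isLt
      omega
    · intro hm
      exact ⟨⟨m, by omega⟩, by simp only; omega, rfl⟩
  rw [← Finset.card_map Fin.valEmbedding, hmap, Finset.card_union_of_disjoint, Nat.card_Ico,
    Finset.card_range]
  rw [Finset.disjoint_left]
  intro m hm hm'
  simp only [Finset.mem_Ico, Finset.mem_range] at hm hm'
  omega

/-- Condition (iv) of genericity for `E ∈ Gr′ᵏ`: for `1 ≤ i ≤ N-k-1`,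
`(E + V_{[N-i+1,N]}) ∩ (E + V_{[1,N-k-i]}) = E`. The 1-indexed interval `[N-i+1,N]` corresponds
to `{j : Fin N | N - i ≤ (j : ℕ)}` and `[1,N-k-i]` to `{j : Fin N | (j : ℕ) < N - k - i}`. -/
theorem stmt5 (N k : ℕ) (hN : 2 ≤ N) (hk1 : 1 ≤ k) (hk2 : k ≤ N - 1)
    (E : Submodule ℝ (Fin N → ℝ)) (hE : Module.finrank ℝ E = k)
    (hgen : ∀ I : Finset (Fin N), I.card = N - k → E ⊓ coordSubspace N ↑I = ⊥) :
    ∀ i : ℕ, 1 ≤ i → i ≤ N - k - 1 →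
      (E ⊔ coordSubspace N {j : Fin N | N - i ≤ (j : ℕ)}) ⊓
        (E ⊔ coordSubspace N {j : Fin N | (j : ℕ) < N - k - i}) = E := by
  intro i hi1 hi2
  apply Submodule.sup_inf_sup_eq_left_of_disjoint
  · rw [← coordSubspace_union]
    have hcard := Fin.card_filter_le_or_lt (N := N) (a := N - k - i) (b := N - i)
      (by omega) (by omega)
    have h := hgen _ (hcard.trans (by omega))
    rwa [Finset.coe_filter_univ, Set.ofPred_or] at h
  · apply disjoint_coordSubspace
    rw [Set.disjoint_left]
    intro j hj hj'
    simp only [Set.mem_ofPred_eq] at hj hj'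
    omega
end

section
/- Every E ∈ Gr′ᵏ is generic, i.e. Gr′ᵏ ⊆ Gr^{k*} (statement 0.4(b) of the paper): if E is a k-dimensional subspace of V with E ∩ V_I = 0 for every I ⊆ {1,…,N} with |I| = N−k, then (i) E ∩ V_{[1,N−k]} = 0, (ii) E ∩ V_{[k+1,N]} = 0, (iii) (E ∩ V_{[k−i+1,N]}) ∩ (E ∩ V_{[1,N−i]}) = 0 for all i ∈ [1,k−1], and (iv) (E + V_{[N−i+1,N]}) ∩ (E + V_{[1,N−k−i]}) = E for all i ∈ [1,N−k−1]. -/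
/-- `E` is generic (lies in `Gr^{k*}`): conditions (i)-(iv) of 0.4. The 1-indexed intervals
`[1,m]` and `[a,N]` correspond to `{j : Fin N | (j : ℕ) < m}` and `{j : Fin N | a - 1 ≤ (j : ℕ)}`
respectively. -/
def IsGeneric (N k : ℕ) (E : Submodule ℝ (Fin N → ℝ)) : Prop :=
  E ⊓ coordSubspace N {j : Fin N | (j : ℕ) < N - k} = ⊥ ∧
  E ⊓ coordSubspace N {j : Fin N | k ≤ (j : ℕ)} = ⊥ ∧
  (∀ i : ℕ, 1 ≤ i → i ≤ k - 1 →
    (E ⊓ coordSubspace N {j : Fin N | k - i ≤ (j : ℕ)}) ⊓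
      (E ⊓ coordSubspace N {j : Fin N | (j : ℕ) < N - i}) = ⊥) ∧
  (∀ i : ℕ, 1 ≤ i → i ≤ N - k - 1 →
    (E ⊔ coordSubspace N {j : Fin N | N - i ≤ (j : ℕ)}) ⊓
      (E ⊔ coordSubspace N {j : Fin N | (j : ℕ) < N - k - i}) = E)

theorem mem_coordSubspace_iff {N : ℕ} {S : Set (Fin N)} {x : Fin N → ℝ} :
    x ∈ coordSubspace N S ↔ ∀ j ∉ S, x j = 0 := by
  constructor
  · intro hx j hj
    have hle : coordSubspace N S ≤ LinearMap.ker (LinearMap.proj (R := ℝ) (φ := fun _ => ℝ) j) := by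
      refine Submodule.span_le.2 ?_
      rintro _ ⟨i, hi, rfl⟩
      have hij : j ≠ i := fun h => hj (h ▸ hi)
      simp [hij]
    simpa using hle hx
  · intro hx
    rw [pi_eq_sum_univ' x]
    refine Submodule.sum_mem _ fun j _ => ?_
    by_cases hj : j ∈ S
    · refine Submodule.smul_mem _ _ (Submodule.subset_span ⟨j, hj, ?_⟩)
      ext l
      simp [Pi.single_apply, eq_comm]
    · simp [hx j hj]

theorem Fin.card_filter_le_and_lt {N a b : ℕ} (hb : b ≤ N) :
    (Finset.univ.filter fun j : Fin N => a ≤ (j : ℕ) ∧ (j : ℕ) < b).card = b - a := by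
  rw [← Nat.card_Ico, ← Finset.card_map Fin.valEmbedding]
  congr 1
  ext l
  simp only [Finset.mem_map, Finset.mem_filter, Finset.mem_univ, true_and, Fin.valEmbedding_apply,
    Finset.mem_Ico]
  constructor
  · rintro ⟨j, hj, rfl⟩
    exact hj
  · intro hl
    exact ⟨⟨l, by omega⟩, hl, rfl⟩

/-- Statement 0.4(b): `Gr′ᵏ ⊆ Gr^{k*}`, i.e. every `k`-dimensional `E` with `E ∩ V_I = 0` for
all `I` with `|I| = N - k` is generic. -/
theorem stmt6 (N k : ℕ) (hN : 2 ≤ N) (hk1 : 1 ≤ k) (hk2 : k ≤ N - 1)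
    (E : Submodule ℝ (Fin N → ℝ)) (hE : Module.finrank ℝ E = k)
    (hgen : ∀ I : Finset (Fin N), I.card = N - k → E ⊓ coordSubspace N ↑I = ⊥) :
    IsGeneric N k E := by
  have hgen' : ∀ I : Finset (Fin N), I.card = N - k → ∀ x ∈ E, (∀ j ∉ I, x j = 0) → x = 0 := by
    intro I hI x hxE hx
    have hmem : x ∈ E ⊓ coordSubspace N ↑I := ⟨hxE, mem_coordSubspace_iff.2 (by simpa using hx)⟩
    rwa [hgen I hI, Submodule.mem_bot] at hmem
  have interval : ∀ a b : ℕ, b ≤ N → b - a = N - k → ∀ x ∈ E,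
      (∀ j : Fin N, ¬(a ≤ (j : ℕ) ∧ (j : ℕ) < b) → x j = 0) → x = 0 := by
    intro a b hb hab x hxE hx
    refine hgen' _ ((Fin.card_filter_le_and_lt hb).trans hab) x hxE fun j hj => hx j ?_
    simpa using hj
  refine ⟨?_, ?_, ?_, ?_⟩
  · refine (Submodule.eq_bot_iff _).2 ?_
    rintro x ⟨hxE, hx⟩
    refine interval 0 (N - k) (by omega) (by omega) x hxE fun j hj => ?_
    exact mem_coordSubspace_iff.1 hx j (by simp only [Set.mem_ofPred_eq]; omega)
  · refine (Submodule.eq_bot_iff _).2 ?_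
    rintro x ⟨hxE, hx⟩
    refine interval k N le_rfl rfl x hxE fun j hj => ?_
    exact mem_coordSubspace_iff.1 hx j (by simp only [Set.mem_ofPred_eq]; omega)
  · intro i hi1 hi2
    refine (Submodule.eq_bot_iff _).2 ?_
    rintro x ⟨⟨hxE, hx⟩, -, hx'⟩
    refine interval (k - i) (N - i) (by omega) (by omega) x hxE fun j hj => ?_
    by_cases hjk : k - i ≤ (j : ℕ)
    · exact mem_coordSubspace_iff.1 hx' j (by simp only [Set.mem_ofPred_eq]; omega)
    · exact mem_coordSubspace_iff.1 hx j (by simp only [Set.mem_ofPred_eq]; omega)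
  · intro i hi1 hi2
    refine le_antisymm ?_ (le_inf le_sup_left le_sup_left)
    rintro x ⟨hx, hx'⟩
    obtain ⟨e, he, a, ha, rfl⟩ := Submodule.mem_sup.1 hx
    obtain ⟨e', he', b, hb, heq⟩ := Submodule.mem_sup.1 hx'
    rw [mem_coordSubspace_iff] at ha hb
    simp only [Set.mem_ofPred_eq] at ha hb
    have hcard : (Finset.univ.filter
        fun j : Fin N => N - k - i ≤ (j : ℕ) ∧ (j : ℕ) < N - i)ᶜ.card = N - k := by
      rw [Finset.card_compl, Fin.card_filter_le_and_lt (by omega), Fintype.card_fin]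
      omega
    have hba : b - a = e - e' := by
      rw [sub_eq_sub_iff_add_eq_add, add_comm b, heq]
    have hab : b - a = 0 := by
      refine hgen' _ hcard _ (hba ▸ E.sub_mem he he') fun j hj => ?_
      simp only [Finset.mem_compl, Finset.mem_filter, Finset.mem_univ, true_and, not_not] at hj
      simp [ha j (by omega), hb j (by omega)]
    have ha0 : a = 0 := by
      ext j
      by_cases hj : N - i ≤ (j : ℕ)
      · rw [← sub_eq_zero.1 hab]
        exact hb j (by omega)
      · exact ha j hj
    simpa [ha0] using he
end

section
/- Every N×k real matrix M of rank k all of whose k×k minors are ≥ 0 lies in the closure, in the space of N×k real matrices, of the set of N×k matrices all of whose k×k minors are > 0. (This is a matrix-level form of statement 0.6(a), Gr′ᵏ_{≥0} = Gr^k_{≥0}: every k-plane with nonnegative Plücker coordinates is a limit of k-planes with positive Plücker coordinates, obtained as the limit r → 0 of exp(rA)·M.) -/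
/-- The maximal (`k×k`) minor of an `N×k` matrix on the row set `I` (with `I.card = k`). -/
noncomputable def maxMinor {N k : ℕ} (M : Matrix (Fin N) (Fin k) ℝ)
    (I : Finset (Fin N)) (hI : I.card = k) : ℝ :=
  (M.submatrix (fun a => ((I.orderIsoOfFin hI a : I) : Fin N)) id).det

/-- Expansion of the determinant of a product `A * B` along all choices of rows of `B`. -/
theorem det_mul_eq_sum_prod_mul_det {N k : ℕ} (A : Matrix (Fin k) (Fin N) ℝ)
    (B : Matrix (Fin N) (Fin k) ℝ) :
    (A * B).det = ∑ f : Fin k → Fin N, (∏ a, A a (f a)) * (B.submatrix f id).det := by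
  have h : A * B = fun a => ∑ j, A a j • B j := by
    ext a b
    simp [Matrix.mul_apply, Finset.sum_apply]
  calc (A * B).det
      = Matrix.detRowAlternating.toMultilinearMap (fun a => ∑ j, A a j • B j) := by rw [h]; rfl
    _ = _ := by
      rw [MultilinearMap.map_sum]
      refine Finset.sum_congr rfl fun f _ => ?_
      rw [MultilinearMap.map_smul_univ]
      rfl

theorem det_ne_zero_of_rank_eq {k : ℕ} (A : Matrix (Fin k) (Fin k) ℝ) (h : A.rank = k) :
    A.det ≠ 0 := by
  have hsurj : Function.Surjective A.mulVec := by
    have : LinearMap.range A.mulVecLin = ⊤ :=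
      Submodule.eq_top_of_finrank_eq (by simpa [Matrix.rank] using h)
    exact LinearMap.range_eq_top.mp this
  exact ((Matrix.isUnit_iff_isUnit_det A).mp
    (Matrix.mulVec_surjective_iff_isUnit.mp hsurj)).ne_zero

theorem exists_det_submatrix_ne_zero {N k : ℕ} (M : Matrix (Fin N) (Fin k) ℝ)
    (hM : M.rank = k) : ∃ f : Fin k → Fin N, (M.submatrix f id).det ≠ 0 := by
  by_contra! h
  refine det_ne_zero_of_rank_eq (M.transpose * M) (by rw [Matrix.rank_transpose_mul_self, hM]) ?_
  simp [det_mul_eq_sum_prod_mul_det, h]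

theorem det_submatrix_nonneg_of_strictMono {N k : ℕ} {M : Matrix (Fin N) (Fin k) ℝ}
    (hM : ∀ (I : Finset (Fin N)) (hI : I.card = k), 0 ≤ maxMinor M I hI)
    {f : Fin k → Fin N} (hf : StrictMono f) : 0 ≤ (M.submatrix f id).det := by
  have hI : (Finset.univ.image f).card = k := by
    simp [Finset.card_image_of_injective _ hf.injective]
  have h := Finset.orderEmbOfFin_unique hI (f := f) (by simp) hf
  have := hM _ hI
  rw [maxMinor] at this
  rw [h]
  exact this

theorem injective_of_det_submatrix_ne_zero {N k : ℕ} {M : Matrix (Fin N) (Fin k) ℝ}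
    {f : Fin k → Fin N} (hf : (M.submatrix f id).det ≠ 0) : Function.Injective f := by
  intro a b hab
  by_contra hne
  exact hf (Matrix.det_zero_of_row_eq hne (by ext c; simp [hab]))

/-- The squared distance between two row selections. -/
def rowSqDist {N k : ℕ} (i f : Fin k → Fin N) : ℕ :=
  ∑ a, ((i a : ℤ) - (f a : ℤ)).natAbs ^ 2

theorem rowSqDist_cast {N k : ℕ} (i f : Fin k → Fin N) :
    (rowSqDist i f : ℤ) =
      ∑ a, (i a : ℤ) ^ 2 + ∑ a, (f a : ℤ) ^ 2 - 2 * ∑ a, (i a : ℤ) * (f a : ℤ) := by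
  simp only [rowSqDist, Nat.cast_sum, Nat.cast_pow, Int.natCast_natAbs, sq_abs, Finset.mul_sum,
    ← Finset.sum_add_distrib, ← Finset.sum_sub_distrib]
  exact Finset.sum_congr rfl fun a _ => by ring

/-- Sorting a row selection brings it strictly closer to an increasing one. -/
theorem rowSqDist_comp_sort_lt {N k : ℕ} {i f : Fin k → Fin N} (hi : StrictMono i)
    (hf : ¬ Monotone f) : rowSqDist i (f ∘ Tuple.sort f) < rowSqDist i f := by
  set σ := Tuple.sort f
  have hmono : Monotone fun a => ((f (σ a) : ℕ) : ℤ) := fun a b hab => by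
    have := Tuple.monotone_sort f hab
    simpa using this
  have himono : Monotone fun a => ((i a : ℕ) : ℤ) := fun a b hab => by
    simpa using hi.monotone hab
  have key := ((himono.monovary hmono).sum_mul_comp_perm_lt_sum_mul_iff (σ := σ⁻¹)).mpr (by
    intro h
    refine hf (monotone_iff_forall_lt.mpr fun a b hab => ?_)
    by_contra hlt
    have := h (i := b) (j := a) (by simpa using hlt)
    exact absurd (hi hab) (by simpa using this))
  have hsq : ∑ a, ((f (σ a) : ℕ) : ℤ) ^ 2 = ∑ a, ((f a : ℕ) : ℤ) ^ 2 :=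
    Equiv.sum_comp σ fun a => ((f a : ℕ) : ℤ) ^ 2
  have h1 := rowSqDist_cast i f
  have h2 := rowSqDist_cast i (f ∘ σ)
  have hσ : ∀ a, σ (σ⁻¹ a) = a := σ.apply_symm_apply
  simp only [Function.comp_apply] at h2
  simp only [hσ] at key
  zify
  linarith

/-- The Gaussian kernel `q ^ (i - j)²`, which tends to the identity as `q → 0`. -/
def gaussKernel (N : ℕ) (q : ℝ) : Matrix (Fin N) (Fin N) ℝ :=
  Matrix.of fun i j => q ^ (((i : ℤ) - (j : ℤ)).natAbs ^ 2)

theorem gaussKernel_zero (N : ℕ) : gaussKernel N 0 = 1 := by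
  ext i j
  rcases eq_or_ne i j with rfl | h
  · simp [gaussKernel]
  · have : (i : ℤ) - (j : ℤ) ≠ 0 := by
      simpa [sub_eq_zero, Fin.val_inj] using h
    simp [gaussKernel, h, this]

theorem continuous_gaussKernel (N : ℕ) : Continuous (gaussKernel N) :=
  continuous_matrix fun _ _ => continuous_pow _

theorem det_submatrix_gaussKernel_mul {N k : ℕ} (M : Matrix (Fin N) (Fin k) ℝ)
    (i : Fin k → Fin N) (q : ℝ) :
    ((gaussKernel N q * M).submatrix i id).det =
      ∑ f : Fin k → Fin N, q ^ rowSqDist i f * (M.submatrix f id).det := by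
  rw [show (gaussKernel N q * M).submatrix i id = (gaussKernel N q).submatrix i id * M by
    ext; simp [Matrix.mul_apply], det_mul_eq_sum_prod_mul_det]
  simp [gaussKernel, rowSqDist, Finset.prod_pow_eq_pow_sum]

open Filter Topology in
theorem eventually_det_submatrix_gaussKernel_mul_pos {N k : ℕ} {M : Matrix (Fin N) (Fin k) ℝ}
    (hrank : M.rank = k)
    (hM : ∀ (I : Finset (Fin N)) (hI : I.card = k), 0 ≤ maxMinor M I hI)
    {i : Fin k → Fin N} (hi : StrictMono i) :
    ∀ᶠ q in 𝓝[>] (0 : ℝ), 0 < ((gaussKernel N q * M).submatrix i id).det := by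
  set d : (Fin k → Fin N) → ℝ := fun f => (M.submatrix f id).det with hd
  set S : Finset (Fin k → Fin N) := Finset.univ.filter fun f => d f ≠ 0 with hS
  obtain ⟨f₁, hf₁⟩ := exists_det_submatrix_ne_zero M hrank
  obtain ⟨f₀, hf₀, hmin⟩ := S.exists_min_image (rowSqDist i) ⟨f₁, by simpa [hS] using hf₁⟩
  set m := rowSqDist i f₀ with hm
  have hpos : ∀ f ∈ S, rowSqDist i f = m → 0 < d f := by
    intro f hfS hfm
    have hf : d f ≠ 0 := by simpa [hS] using hfS
    have hmono : Monotone f := by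
      by_contra hnot
      have hlt := rowSqDist_comp_sort_lt hi hnot
      have hmem : f ∘ Tuple.sort f ∈ S := by
        have : d (f ∘ Tuple.sort f) = Equiv.Perm.sign (Tuple.sort f) * d f :=
          Matrix.det_permute (Tuple.sort f) (M.submatrix f id)
        simp [hS, this, hf]
      have := hmin _ hmem
      omega
    exact lt_of_le_of_ne (det_submatrix_nonneg_of_strictMono hM
      (hmono.strictMono_of_injective (injective_of_det_submatrix_ne_zero hf))) hf.symm
  set g : ℝ → ℝ := fun q => ∑ f ∈ S, q ^ (rowSqDist i f - m) * d f with hg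
  have hg0 : 0 < g 0 := by
    refine Finset.sum_pos' (fun f hf => ?_) ⟨f₀, hf₀, ?_⟩
    · rcases (hmin f hf).eq_or_lt with h | h
      · simpa [← h] using (hpos f hf h.symm).le
      · simp [zero_pow (Nat.sub_pos_of_lt h).ne']
    · simpa [← hm] using hpos f₀ hf₀ rfl
  have hgc : Continuous g := by fun_prop
  have hev : ∀ᶠ q in 𝓝[>] (0 : ℝ), 0 < g q :=
    nhdsWithin_le_nhds (hgc.continuousAt.eventually (lt_mem_nhds hg0))
  filter_upwards [hev, self_mem_nhdsWithin] with q hq hq0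
  have : ((gaussKernel N q * M).submatrix i id).det = q ^ m * g q := by
    rw [det_submatrix_gaussKernel_mul, hg, Finset.mul_sum]
    rw [← Finset.sum_filter_of_ne (p := fun f => d f ≠ 0) fun f _ h => right_ne_zero_of_mul h]
    refine Finset.sum_congr rfl fun f hf => ?_
    rw [← mul_assoc, ← pow_add, Nat.add_sub_cancel' (hmin f hf)]
  rw [this]
  exact mul_pos (pow_pos hq0 m) hq

/-- Every `N×k` matrix `M` of rank `k` with all maximal minors `≥ 0` lies in the closure of the
set of `N×k` matrices with all maximal minors `> 0`. -/
theorem stmt10 (N k : ℕ) (hN : 2 ≤ N) (hk1 : 1 ≤ k) (hk2 : k ≤ N - 1)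
    (M : Matrix (Fin N) (Fin k) ℝ) (hrank : M.rank = k)
    (hM : ∀ (I : Finset (Fin N)) (hI : I.card = k), 0 ≤ maxMinor M I hI) :
    M ∈ closure {P : Matrix (Fin N) (Fin k) ℝ |
      ∀ (I : Finset (Fin N)) (hI : I.card = k), 0 < maxMinor P I hI} := by
  have htend : Filter.Tendsto (fun q => gaussKernel N q * M) (nhdsWithin 0 (Set.Ioi 0))
      (nhds M) := by
    have hc : Continuous fun q => gaussKernel N q * M :=
      (continuous_gaussKernel N).matrix_mul continuous_const
    simpa [gaussKernel_zero] using (hc.tendsto 0).mono_left nhdsWithin_le_nhds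
  refine mem_closure_of_tendsto htend (Filter.eventually_all.mpr fun I =>
    Filter.eventually_all.mpr fun hI => ?_)
  exact eventually_det_submatrix_gaussKernel_mul_pos hrank hM (I.orderEmbOfFin hI).strictMono
end

section
/- The set of N×k real matrices all of whose k×k minors are positive is path-connected. (This is a matrix-level consequence of Theorem 0.5 (Rietsch): Gr′ᵏ_{>0} = Gr^k_{>0}, together with the fact from 0.4(a) that Gr^k_{>0} is connected; a matrix M with all maximal minors positive determines a k-plane with positive Plücker coordinates, and the fibers of the column-span map over such planes are copies of the connected group GL_k^+(ℝ).) -/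
section

open Matrix Topology

namespace Matrix.SpecialLinearGroup

variable {ι : Type*} [Fintype ι] [DecidableEq ι]

theorem joined_one_transvection {i j : ι} (hij : i ≠ j) (c : ℝ) :
    Joined (1 : SpecialLinearGroup ι ℝ) (transvection hij c) := by
  have hcont : Continuous fun t : ℝ => transvection hij (t * c) := by
    refine Continuous.subtype_mk (f := fun t : ℝ => Matrix.transvection i j (t * c)) ?_ _
    refine continuous_const.add (continuous_matrix fun x y => ?_)
    simp only [single_apply]
    split_ifs <;> fun_prop
  exact (JoinedIn.ofLine (F := Set.univ) hcont.continuousOn (by simp [transvection_coeff_zero])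
    (by simp) (Set.subset_univ _)).joined

theorem diag2n_eq_prod_transvection {F : Type*} [Field F] {i j : ι} (hij : i ≠ j) {a : F}
    (ha : a ≠ 0) :
    diag2n hij a ha = transvection hij a * transvection hij.symm (-a⁻¹) * transvection hij a *
      transvection hij (-1) * transvection hij.symm 1 * transvection hij (-1) := by
  have key : diagonal (fun k => if k = i then a else if k = j then a⁻¹ else 1) =
      Matrix.transvection i j a * Matrix.transvection j i (-a⁻¹) * Matrix.transvection i j a *
      Matrix.transvection i j (-1) * Matrix.transvection j i 1 * Matrix.transvection i j (-1) := by
    simp only [Matrix.transvection]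
    simp [mul_add, add_mul, ha, hij, hij.symm]
    ext x y
    simp only [diagonal_apply, single_apply, one_apply, Matrix.add_apply]
    grind
  exact Subtype.ext key

theorem joined_one (A : SpecialLinearGroup ι ℝ) : Joined 1 A := by
  cases subsingleton_or_nontrivial ι
  · rw [Subsingleton.elim A 1]
  have hmul : ∀ A B : SpecialLinearGroup ι ℝ, Joined 1 A → Joined 1 B → Joined 1 (A * B) :=
    fun A B hA hB => by simpa using hA.mul hB
  refine diagonal_transvection_induction' (Joined 1) A (fun i j hij c hc => ?_)
    (fun i j hij c => joined_one_transvection hij c) hmul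
  rw [diag2n_eq_prod_transvection]
  refine hmul _ _ (hmul _ _ (hmul _ _ (hmul _ _ (hmul _ _ ?_ ?_) ?_) ?_) ?_) ?_ <;>
    exact joined_one_transvection _ _

instance : PathConnectedSpace (SpecialLinearGroup ι ℝ) where
  nonempty := ⟨1⟩
  joined A B := (joined_one A).symm.trans (joined_one B)

end Matrix.SpecialLinearGroup

theorem Matrix.isPathConnected_det_pos {ι : Type*} [Fintype ι] [DecidableEq ι] [Nonempty ι] :
    IsPathConnected {A : Matrix ι ι ℝ | 0 < A.det} := by
  have hprod : IsPathConnected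
      (Set.Ioi (0 : ℝ) ×ˢ (Set.univ : Set (SpecialLinearGroup ι ℝ))) :=
    ((convex_Ioi 0).isPathConnected ⟨1, one_pos⟩).prod isPathConnected_univ
  convert hprod.image (f := fun p => p.1 • (p.2 : Matrix ι ι ℝ))
    (continuous_fst.smul (continuous_subtype_val.comp continuous_snd))
  ext A
  refine ⟨fun hA => ?_, ?_⟩
  · have hA : 0 < A.det := hA
    have hroot : (A.det ^ ((Fintype.card ι : ℝ)⁻¹)) ^ Fintype.card ι = A.det :=
      Real.rpow_inv_natCast_pow hA.le Fintype.card_ne_zero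
    have hpos : 0 < A.det ^ ((Fintype.card ι : ℝ)⁻¹) := Real.rpow_pos_of_pos hA _
    refine ⟨(A.det ^ ((Fintype.card ι : ℝ)⁻¹),
      ⟨(A.det ^ ((Fintype.card ι : ℝ)⁻¹))⁻¹ • A, ?_⟩), ⟨hpos, trivial⟩, smul_inv_smul₀ hpos.ne' A⟩
    rw [det_smul, inv_pow, hroot, inv_mul_cancel₀ hA.ne']
  · rintro ⟨⟨c, B⟩, ⟨hc, -⟩, rfl⟩
    have hc : 0 < c := hc
    simp [hc]

/-- If a family of convex sets over a path-connected base has a continuous section, then its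
total space is path-connected. -/
theorem IsPathConnected.sigma_of_convex {A E : Type*} [TopologicalSpace A] [TopologicalSpace E]
    [AddCommGroup E] [Module ℝ E] [ContinuousAdd E] [ContinuousSMul ℝ E]
    {S : Set A} (hS : IsPathConnected S) {F : A → Set E} (hF : ∀ a ∈ S, Convex ℝ (F a))
    {g : A → E} (hg : ContinuousOn g S) (hgF : ∀ a ∈ S, g a ∈ F a) :
    IsPathConnected {p : A × E | p.1 ∈ S ∧ p.2 ∈ F p.1} := by
  have hgraph : IsPathConnected ((fun a => (a, g a)) '' S) :=
    hS.image' (continuousOn_id.prodMk hg)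
  have hgraph_sub : (fun a => (a, g a)) '' S ⊆ {p : A × E | p.1 ∈ S ∧ p.2 ∈ F p.1} := by
    rintro _ ⟨a, ha, rfl⟩
    exact ⟨ha, hgF a ha⟩
  obtain ⟨a₀, ha₀⟩ := hS.nonempty
  refine ⟨(a₀, g a₀), ⟨ha₀, hgF a₀ ha₀⟩, ?_⟩
  rintro ⟨a, v⟩ ⟨ha, hv⟩
  have hbase : JoinedIn {p : A × E | p.1 ∈ S ∧ p.2 ∈ F p.1} (a₀, g a₀) (a, g a) :=
    (hgraph.joinedIn _ (Set.mem_image_of_mem _ ha₀) _ (Set.mem_image_of_mem _ ha)).mono hgraph_sub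
  have hfiber : IsPathConnected ((fun w => (a, w)) '' F a) :=
    ((hF a ha).isPathConnected ⟨v, hv⟩).image (by fun_prop)
  refine hbase.trans ((hfiber.joinedIn _ (Set.mem_image_of_mem _ (hgF a ha)) _
    (Set.mem_image_of_mem _ hv)).mono ?_)
  rintro _ ⟨w, hw, rfl⟩
  exact ⟨ha, hw⟩

/-- Matrices, as families of rows, all of whose maximal minors are positive. -/
def positiveMinors (k N : ℕ) : Set (Fin N → Fin k → ℝ) :=
  {M | ∀ g : Fin k → Fin N, StrictMono g → 0 < detRowAlternating (R := ℝ) (M ∘ g)}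

/-- The rows whose determinant with any increasing selection of `κ` rows of `M` is positive. -/
def positiveRows {κ N : ℕ} (M : Fin N → Fin (κ + 1) → ℝ) : Set (Fin (κ + 1) → ℝ) :=
  {v | ∀ h : Fin κ → Fin N, StrictMono h → 0 < detRowAlternating (R := ℝ) (vecCons v (M ∘ h))}

theorem detRowAlternating_vecCons_add_smul {κ : ℕ} (u v : Fin (κ + 1) → ℝ) (c : ℝ)
    (A : Fin κ → Fin (κ + 1) → ℝ) :
    detRowAlternating (R := ℝ) (vecCons (u + c • v) A) =
      detRowAlternating (R := ℝ) (vecCons u A) + c * detRowAlternating (R := ℝ) (vecCons v A) := by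
  rw [AlternatingMap.map_vecCons_add, AlternatingMap.map_vecCons_smul, smul_eq_mul]

theorem convex_positiveRows {κ N : ℕ} (M : Fin N → Fin (κ + 1) → ℝ) :
    Convex ℝ (positiveRows M) := by
  intro u hu v hv a b ha hb hab h hh
  have hu := hu h hh
  have hv := hv h hh
  rw [detRowAlternating_vecCons_add_smul, AlternatingMap.map_vecCons_smul, smul_eq_mul]
  rcases ha.eq_or_lt with rfl | ha
  · obtain rfl : b = 1 := by linarith
    simpa
  · positivity

theorem Fin.exists_strictMono_insertNth {κ N : ℕ} {h : Fin κ → Fin N} (hh : StrictMono h)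
    {s : Fin N} (hs : s ∉ Set.range h) (hlt : ∀ i < s, i ∈ Set.range h) :
    ∃ q : Fin (κ + 1), (q : ℕ) = s ∧ StrictMono (q.insertNth s h : Fin (κ + 1) → Fin N) := by
  have hle : ∀ n (hn : n < κ), n ≤ h ⟨n, hn⟩ := by
    intro n
    induction n with
    | zero => simp
    | succ n ih =>
      intro hn
      have h1 := ih (by omega)
      have h2 : h ⟨n, by omega⟩ < h ⟨n + 1, hn⟩ := hh (by simp)
      rw [Fin.lt_def] at h2
      omega
  have hfix : ∀ n < (s : ℕ), ∃ hn : n < κ, (h ⟨n, hn⟩ : ℕ) = n := by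
    intro n
    induction n using Nat.strong_induction_on with
    | _ n ih =>
      intro hn
      obtain ⟨j, hj⟩ := hlt ⟨n, hn.trans s.2⟩ hn
      have hj' : (h j : ℕ) = n := by rw [hj]
      have hjle : (j : ℕ) ≤ n := hj' ▸ hle j j.2
      rcases hjle.eq_or_lt with rfl | hjlt
      · exact ⟨j.2, hj'⟩
      · obtain ⟨_, h2⟩ := ih j hjlt (hjlt.trans hn)
        simp only [Fin.eta] at h2
        omega
  have hsκ : (s : ℕ) ≤ κ := by
    by_contra! hκ
    exact absurd (hfix κ hκ).1 (lt_irrefl κ)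
  refine ⟨⟨s, by omega⟩, rfl, (Fin.strictMono_insertNth_iff _ _ _).2 ⟨hh, ?_, ?_⟩⟩
  · intro i hi
    have hi' : (i : ℕ) < s := hi
    obtain ⟨_, h2⟩ := hfix i hi'
    simp only [Fin.eta] at h2
    rw [Fin.lt_def]
    omega
  · intro i hi
    have hi' : (s : ℕ) ≤ i := hi
    exact lt_of_le_of_ne (Fin.le_def.2 (hi'.trans (hle i i.2))) fun he => hs ⟨i, he.symm⟩

/-- Alternating combinations of the first `s` rows, with rapidly decreasing coefficients, have
positive determinant with every selection of rows that omits one of the first `s` rows. -/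
theorem exists_row_pos_of_omits {κ N : ℕ} {M : Fin N → Fin (κ + 1) → ℝ}
    (hM : M ∈ positiveMinors (κ + 1) N) (s : ℕ) (hs : s ≤ N) :
    ∃ v : Fin (κ + 1) → ℝ, ∀ h : Fin κ → Fin N, StrictMono h →
      ((∃ i : Fin N, (i : ℕ) < s ∧ i ∉ Set.range h) →
        0 < detRowAlternating (R := ℝ) (vecCons v (M ∘ h))) ∧
      ((∀ i : Fin N, (i : ℕ) < s → i ∈ Set.range h) →
        detRowAlternating (R := ℝ) (vecCons v (M ∘ h)) = 0) := by
  induction s with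
  | zero => exact ⟨0, fun h _ => ⟨by simp, fun _ => AlternatingMap.map_coord_zero _ 0 rfl⟩⟩
  | succ s ih =>
    obtain ⟨v, hv⟩ := ih (by omega)
    let r : Fin N := ⟨s, hs⟩
    have hev : ∀ᶠ ε : ℝ in 𝓝[>] 0, ∀ h : Fin κ → Fin N,
        0 < detRowAlternating (R := ℝ) (vecCons v (M ∘ h)) →
        0 < detRowAlternating (R := ℝ) (vecCons v (M ∘ h)) +
          ε * (-1) ^ s * detRowAlternating (R := ℝ) (vecCons (M r) (M ∘ h)) := by
      refine Filter.eventually_all.2 fun h => ?_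
      by_cases hpos : 0 < detRowAlternating (R := ℝ) (vecCons v (M ∘ h))
      · have hcont : Continuous fun ε : ℝ => detRowAlternating (R := ℝ) (vecCons v (M ∘ h)) +
            ε * (-1) ^ s * detRowAlternating (R := ℝ) (vecCons (M r) (M ∘ h)) := by fun_prop
        have := (hcont.tendsto 0).eventually_const_lt (u := 0) (by simpa using hpos)
        filter_upwards [nhdsWithin_le_nhds this] with ε hε _ using hε
      · exact Filter.Eventually.of_forall fun _ hp => absurd hp hpos
    obtain ⟨ε, hε, hε0⟩ := (hev.and self_mem_nhdsWithin).exists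
    refine ⟨v + (ε * (-1) ^ s) • M r, fun h hh => ?_⟩
    rw [detRowAlternating_vecCons_add_smul]
    have hzero : r ∈ Set.range h →
        detRowAlternating (R := ℝ) (vecCons (M r) (M ∘ h)) = 0 := by
      rintro ⟨j, hj⟩
      exact AlternatingMap.map_eq_zero_of_eq _ _ (i := 0) (j := j.succ) (by simp [hj])
        (Fin.succ_ne_zero j).symm
    refine ⟨fun ⟨i, his, hi⟩ => ?_, fun hall => ?_⟩
    · by_cases hex : ∃ i : Fin N, (i : ℕ) < s ∧ i ∉ Set.range h
      · exact hε h ((hv h hh).1 hex)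
      · push Not at hex
        obtain rfl : i = r := by
          by_contra hne
          exact hi (hex i (lt_of_le_of_ne (Nat.lt_succ_iff.1 his) fun he => hne (Fin.ext he)))
        obtain ⟨q, hq, hmono⟩ := Fin.exists_strictMono_insertNth hh hi fun j hj => hex j hj
        have hdet := hM _ hmono
        have hcomp : M ∘ (q.insertNth r h : Fin (κ + 1) → Fin N) =
            q.insertNth (M r) (M ∘ h) := by
          ext1 j
          cases j using Fin.succAboveCases q <;> simp
        rw [hcomp, AlternatingMap.map_insertNth, hq, zsmul_eq_mul, Int.cast_pow, Int.cast_neg,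
          Int.cast_one] at hdet
        rw [(hv h hh).2 hex, zero_add, mul_assoc]
        exact mul_pos hε0 hdet
    · rw [(hv h hh).2 fun i hi => hall i (by omega), hzero (hall r (by simp [r])), mul_zero,
        add_zero]

theorem positiveRows_nonempty {κ N : ℕ} (hN : κ + 1 ≤ N) {M : Fin N → Fin (κ + 1) → ℝ}
    (hM : M ∈ positiveMinors (κ + 1) N) : (positiveRows M).Nonempty := by
  obtain ⟨v, hv⟩ := exists_row_pos_of_omits hM (κ + 1) hN
  refine ⟨v, fun h hh => (hv h hh).1 ?_⟩
  by_contra! hall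
  choose f hf using fun i : Fin (κ + 1) => hall (Fin.castLE hN i) i.2
  have hinj : Function.Injective f := fun i j hij =>
    Fin.castLE_injective hN (by rw [← hf, ← hf, hij])
  simpa using Fintype.card_le_of_injective f hinj

theorem continuous_detRowAlternating {n : ℕ} :
    Continuous fun A : Fin n → Fin n → ℝ => detRowAlternating (R := ℝ) A :=
  Continuous.matrix_det (A := fun A : Fin n → Fin n → ℝ => (A : Matrix (Fin n) (Fin n) ℝ))
    continuous_id

theorem cons_mem_positiveMinors_iff {κ N : ℕ} {M : Fin N → Fin (κ + 1) → ℝ}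
    {v : Fin (κ + 1) → ℝ} :
    (Fin.cons v M : Fin (N + 1) → Fin (κ + 1) → ℝ) ∈ positiveMinors (κ + 1) (N + 1) ↔
      M ∈ positiveMinors (κ + 1) N ∧ v ∈ positiveRows M := by
  refine ⟨fun hM => ⟨fun g hg => ?_, fun h hh => ?_⟩, fun ⟨hM, hv⟩ g hg => ?_⟩
  · exact hM (Fin.succ ∘ g) (Fin.strictMono_succ.comp hg)
  · have := hM (Fin.cons 0 (Fin.succ ∘ h))
      (Fin.strictMono_cons.2 ⟨fun j => Fin.succ_pos _, Fin.strictMono_succ.comp hh⟩)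
    convert this using 2
    ext1 j
    cases j using Fin.cases <;> rfl
  · have hsucc : ∀ i : Fin κ, g i.succ ≠ 0 := fun i =>
      ((Fin.zero_le _).trans_lt (hg (Fin.succ_pos i))).ne'
    by_cases h0 : g 0 = 0
    · have := hv (fun i => (g i.succ).pred (hsucc i))
        fun i j hij => by simpa using hg (Fin.succ_lt_succ_iff.2 hij)
      convert this using 2
      ext1 j
      cases j using Fin.cases with
      | zero => simp [h0]
      | succ j =>
        obtain ⟨m, hm⟩ := Fin.exists_succ_eq.2 (hsucc j)
        simp [← hm]
    · have hne : ∀ i, g i ≠ 0 := fun i => Fin.cases h0 hsucc i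
      have := hM (fun i => (g i).pred (hne i)) fun i j hij => by simpa using hg hij
      convert this using 2
      ext1 j
      obtain ⟨m, hm⟩ := Fin.exists_succ_eq.2 (hne j)
      simp [← hm]

theorem isPathConnected_positiveMinors_succ {κ N : ℕ} (hN : κ + 1 ≤ N)
    (hP : IsPathConnected (positiveMinors (κ + 1) N)) :
    IsPathConnected (positiveMinors (κ + 1) (N + 1)) := by
  obtain ⟨g, hg⟩ := exists_continuous_forall_mem_convex_of_local_const
    (X := positiveMinors (κ + 1) N) (t := fun M => positiveRows M.1)
    (fun M => convex_positiveRows M.1) fun M => by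
      obtain ⟨v, hv⟩ := positiveRows_nonempty hN M.2
      refine ⟨v, Filter.eventually_all.2 fun h => ?_⟩
      by_cases hh : StrictMono h
      · have hcont : Continuous fun M : positiveMinors (κ + 1) N =>
            detRowAlternating (R := ℝ) (vecCons v (M.1 ∘ h)) := by
          refine continuous_detRowAlternating.comp
            (Continuous.matrixVecCons continuous_const (continuous_pi fun i => ?_))
          exact (continuous_apply (h i)).comp continuous_subtype_val
        filter_upwards [hcont.continuousAt.eventually_const_lt (hv h hh)] with M' hM' _ using hM'
      · exact Filter.Eventually.of_forall fun _ hp => absurd hp hh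
  classical
  let g' : (Fin N → Fin (κ + 1) → ℝ) → Fin (κ + 1) → ℝ := fun M =>
    if hM : M ∈ positiveMinors (κ + 1) N then g ⟨M, hM⟩ else 0
  have hg' : ∀ M : positiveMinors (κ + 1) N, g' M.1 = g M := fun M => dif_pos M.2
  have htotal := hP.sigma_of_convex (F := positiveRows) (g := g')
    (fun M _ => convex_positiveRows M)
    (continuousOn_iff_continuous_domRestrict.2 (g.continuous.congr fun M => (hg' M).symm))
    (fun M hM => (hg' ⟨M, hM⟩).symm ▸ hg ⟨M, hM⟩)
  convert htotal.image (f := fun p => (Fin.cons p.2 p.1 : Fin (N + 1) → Fin (κ + 1) → ℝ))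
    (by fun_prop)
  ext M
  refine ⟨fun hM => ⟨(Fin.tail M, M 0), ?_, Fin.cons_self_tail M⟩, ?_⟩
  · rw [← Fin.cons_self_tail M] at hM
    exact cons_mem_positiveMinors_iff.1 hM
  · rintro ⟨p, hp, rfl⟩
    exact cons_mem_positiveMinors_iff.2 hp


theorem isPathConnected_positiveMinors (κ m : ℕ) :
    IsPathConnected (positiveMinors (κ + 1) (κ + 1 + m)) := by
  induction m with
  | zero =>
    have heq : {A : Matrix (Fin (κ + 1)) (Fin (κ + 1)) ℝ | 0 < A.det} =
        positiveMinors (κ + 1) (κ + 1) := by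
      ext A
      refine ⟨fun hA g hg => ?_, fun hA => hA id strictMono_id⟩
      obtain rfl : g = id := hg.eq_id
      exact hA
    exact heq ▸ Matrix.isPathConnected_det_pos
  | succ m ih => exact isPathConnected_positiveMinors_succ (Nat.le_add_right _ m) ih

theorem mem_positiveMinors_iff_maxMinor {N k : ℕ} {M : Matrix (Fin N) (Fin k) ℝ} :
    M ∈ positiveMinors k N ↔
      ∀ (I : Finset (Fin N)) (hI : I.card = k), 0 < maxMinor M I hI := by
  refine ⟨fun hM I hI => hM (I.orderEmbOfFin hI) (I.orderEmbOfFin hI).strictMono, fun hM g hg => ?_⟩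
  have hI : (Finset.univ.image g).card = k := by
    simp [Finset.card_image_of_injective _ hg.injective]
  obtain hgI : g = (Finset.univ.image g).orderEmbOfFin hI :=
    Finset.orderEmbOfFin_unique hI (by simp) hg
  have := hM _ hI
  rw [hgI]
  exact this

end

/-- The set of `N×k` real matrices all of whose maximal minors are positive is
path-connected. -/
theorem stmt11 (N k : ℕ) (hN : 2 ≤ N) (hk1 : 1 ≤ k) (hk2 : k ≤ N - 1) :
    IsPathConnected {M : Matrix (Fin N) (Fin k) ℝ |
      ∀ (I : Finset (Fin N)) (hI : I.card = k), 0 < maxMinor M I hI} := by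
  obtain ⟨κ, rfl⟩ := Nat.exists_eq_add_of_le' hk1
  obtain ⟨m, rfl⟩ : ∃ m, N = κ + 1 + m := ⟨N - (κ + 1), by omega⟩
  have heq : positiveMinors (κ + 1) (κ + 1 + m) = {M : Matrix (Fin (κ + 1 + m)) (Fin (κ + 1)) ℝ |
      ∀ (I : Finset (Fin (κ + 1 + m))) (hI : I.card = κ + 1), 0 < maxMinor M I hI} :=
    Set.ext fun _ => mem_positiveMinors_iff_maxMinor
  exact heq ▸ isPathConnected_positiveMinors κ m
end
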